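/- arXiv:2203.00243 — 2 statements merged into one kernel-verified Lean document; each statement's English description precedes it below -/
import Mathlib

section
/- For every 0 ≤ i < j ≤ p and every n ≥ j one has W_{[n,j]} = Σ_{k=i}^{n−j+i} W_{[k,i]} · A^{(i+1)}_{[n−k−1,j−i−1]}. (Equivalently, in terms of generating series, W_j(z) = W_i(z)·A^{(i+1)}_{j−i−1}(z) for all 0 ≤ i < j ≤ p.) -/
open Finset

/-- The height of the path `γ` after `k` steps, starting at height `h0`.
A step encoded by `v : Fin (p + 2)` changes the height by `1 - v`:
`v = 0` is an upstep, `v = 1` a level step and `v = j + 1` a downstep of size `j`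
(for `1 ≤ j ≤ p`). -/
def ht {p n : ℕ} (h0 : ℤ) (γ : Fin n → Fin (p + 2)) (k : ℕ) : ℤ :=
  h0 + ∑ i ∈ Finset.range k, (if h : i < n then 1 - ((γ ⟨i, h⟩ : ℕ) : ℤ) else 0)

/-- The weight of the path `γ` started at height `h0`: upsteps have weight `1`,
a level step at height `m` has weight `a 0 m`, and a downstep of size `j` from
height `m` has weight `a j (m - j)`, i.e. `a j` evaluated at the final height. -/
noncomputable def wt (a : ℕ → ℤ → ℂ) {p n : ℕ} (h0 : ℤ) (γ : Fin n → Fin (p + 2)) : ℂ :=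
  ∏ i : Fin n,
    if (γ i : ℕ) = 0 then 1 else a ((γ i : ℕ) - 1) (ht h0 γ ((i : ℕ) + 1))

open Classical in
/-- `𝒟_{[n,j]}`: the paths of length `n` from `(0,0)` to `(n,j)` whose vertices
all have height `≥ 0`. -/
noncomputable def Dset (p n j : ℕ) : Finset (Fin n → Fin (p + 2)) :=
  Finset.univ.filter fun γ => ht 0 γ n = (j : ℤ) ∧ ∀ k ≤ n, 0 ≤ ht 0 γ k

open Classical in
/-- `𝒫_{[n,j]}`: all paths of length `n` from `(0,0)` to `(n,j)`. -/
noncomputable def Pset (p n j : ℕ) : Finset (Fin n → Fin (p + 2)) :=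
  Finset.univ.filter fun γ => ht 0 γ n = (j : ℤ)

open Classical in
/-- `𝒟̂_{[n,j]}`: the paths of length `n` from `(0,-j)` to `(n,0)` whose vertices
all have height `≤ 0`. -/
noncomputable def Bhset (p n j : ℕ) : Finset (Fin n → Fin (p + 2)) :=
  Finset.univ.filter fun γ =>
    ht (-(j : ℤ)) γ n = 0 ∧ ∀ k ≤ n, ht (-(j : ℤ)) γ k ≤ 0

/-- The weight polynomial `A^{(q)}_{[n,j]}` (so `A_{[n,j]} = Apoly a p 0 n j`):
the sum over `γ ∈ 𝒟_{[n,j]}` of the weight of the upward shift `γ + q`. -/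
noncomputable def Apoly (a : ℕ → ℤ → ℂ) (p : ℕ) (q : ℤ) (n j : ℕ) : ℂ :=
  ∑ γ ∈ Dset p n j, wt a q γ

/-- The weight polynomial `W_{[n,j]} = Σ_{γ ∈ 𝒫_{[n,j]}} w(γ)`. -/
noncomputable def Wpoly (a : ℕ → ℤ → ℂ) (p n j : ℕ) : ℂ :=
  ∑ γ ∈ Pset p n j, wt a 0 γ

/-- The weight polynomial `B^{(q)}_{[n,j]}`: the sum over `γ ∈ 𝒟̂_{[n,j]}` of the
weight of the downward shift `γ - q` (a path starting at height `-j - q`). -/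
noncomputable def Bpoly (a : ℕ → ℤ → ℂ) (p : ℕ) (q : ℤ) (n j : ℕ) : ℂ :=
  ∑ γ ∈ Bhset p n j, wt a (-(j : ℤ) - q) γ


theorem aux_ht_snoc {p n : ℕ} (h0 : ℤ) (γ : Fin n → Fin (p + 2)) (v : Fin (p + 2)) (k : ℕ)
    (hk : k ≤ n) : ht h0 (Fin.snoc γ v : Fin (n + 1) → Fin (p + 2)) k = ht h0 γ k := by
  unfold ht
  congr 1
  apply Finset.sum_congr rfl
  intro x hx
  have hx' : x < n := lt_of_lt_of_le (Finset.mem_range.mp hx) hk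
  rw [dif_pos hx', dif_pos (by omega : x < n + 1)]
  have : (Fin.snoc γ v : Fin (n + 1) → Fin (p + 2)) ⟨x, by omega⟩ = γ ⟨x, hx'⟩ :=
    Fin.snoc_castSucc (α := fun _ => Fin (p + 2)) v γ ⟨x, hx'⟩
  rw [this]

theorem aux_ht_snoc_last {p n : ℕ} (h0 : ℤ) (γ : Fin n → Fin (p + 2)) (v : Fin (p + 2)) :
    ht h0 (Fin.snoc γ v : Fin (n + 1) → Fin (p + 2)) (n + 1)
      = ht h0 γ n + 1 - ((v : ℕ) : ℤ) := by
  have h1 := aux_ht_snoc h0 γ v n le_rfl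
  have h2 : (Fin.snoc γ v : Fin (n + 1) → Fin (p + 2)) ⟨n, by omega⟩ = v :=
    Fin.snoc_last (α := fun _ => Fin (p + 2)) v γ
  rw [← h1]
  unfold ht
  rw [Finset.sum_range_succ, dif_pos (by omega : n < n + 1), h2]
  ring

noncomputable def auxC (a : ℕ → ℤ → ℂ) (v : ℕ) (h : ℤ) : ℂ := if v = 0 then 1 else a (v - 1) h

theorem aux_wt_snoc (a : ℕ → ℤ → ℂ) {p n : ℕ} (h0 : ℤ) (γ : Fin n → Fin (p + 2))
    (v : Fin (p + 2)) :
    wt a h0 (Fin.snoc γ v : Fin (n + 1) → Fin (p + 2))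
      = wt a h0 γ * auxC a v (ht h0 γ n + 1 - ((v : ℕ) : ℤ)) := by
  unfold wt
  rw [Fin.prod_univ_castSucc]
  congr 1
  · apply Finset.prod_congr rfl
    intro x _
    rw [Fin.snoc_castSucc (α := fun _ => Fin (p + 2)), Fin.val_castSucc, aux_ht_snoc _ _ _ _ (by omega)]
  · rw [Fin.snoc_last (α := fun _ => Fin (p + 2)), Fin.val_last, aux_ht_snoc_last]
    rfl

open Classical in
noncomputable def auxF (P : ℤ → Prop) (a : ℕ → ℤ → ℂ) (p : ℕ) (q : ℤ) (n : ℕ) (h : ℤ) : ℂ :=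
  ∑ γ : Fin n → Fin (p + 2), if ht q γ n = h ∧ ∀ k ≤ n, P (ht q γ k) then wt a q γ else 0

open Classical in
theorem auxF_zero (P : ℤ → Prop) (a : ℕ → ℤ → ℂ) (p : ℕ) (q : ℤ) (h : ℤ) :
    auxF P a p q 0 h = if q = h ∧ P q then 1 else 0 := by
  simp [auxF, ht, wt]

open Classical in
theorem auxF_succ (P : ℤ → Prop) (a : ℕ → ℤ → ℂ) (p : ℕ) (q : ℤ) (n : ℕ) (h : ℤ) (hP : P h) :
    auxF P a p q (n + 1) h
      = ∑ v : Fin (p + 2), auxC a v h * auxF P a p q n (h - 1 + ((v : ℕ) : ℤ)) := by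
  unfold auxF
  rw [← (Fin.snocEquiv (fun _ : Fin (n + 1) => Fin (p + 2))).sum_comp, Fintype.sum_prod_type]
  apply Finset.sum_congr rfl
  intro v _
  rw [Finset.mul_sum]
  apply Finset.sum_congr rfl
  intro γ _
  have hE : (Fin.snocEquiv (fun _ : Fin (n + 1) => Fin (p + 2))) (v, γ)
      = (Fin.snoc γ v : Fin (n + 1) → Fin (p + 2)) := rfl
  rw [hE]
  rw [aux_ht_snoc_last, aux_wt_snoc]
  by_cases h1 : ht q γ n = h - 1 + ((v : ℕ) : ℤ)
  · have h2 : ht q γ n + 1 - ((v : ℕ) : ℤ) = h := by omega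
    have h3 : (∀ k ≤ n + 1, P (ht q (Fin.snoc γ v : Fin (n + 1) → Fin (p + 2)) k)) ↔
        ∀ k ≤ n, P (ht q γ k) := by
      constructor
      · intro H k hk
        rw [← aux_ht_snoc q γ v k hk]
        exact H k (by omega)
      · intro H k hk
        rcases Nat.lt_or_ge n k with hk' | hk'
        · obtain rfl : k = n + 1 := by omega
          rw [aux_ht_snoc_last, h2]; exact hP
        · rw [aux_ht_snoc q γ v k hk']
          exact H k hk'
    rw [h2]
    simp only [h3, h1, true_and]
    split_ifs <;> ring
  · have h2 : ¬ (ht q γ n + 1 - ((v : ℕ) : ℤ) = h) := by omega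
    simp [h1, h2]

theorem auxF_not (P : ℤ → Prop) (a : ℕ → ℤ → ℂ) (p : ℕ) (q : ℤ) (n : ℕ) (h : ℤ) (hP : ¬ P h) :
    auxF P a p q n h = 0 := by
  unfold auxF
  apply Finset.sum_eq_zero
  intro γ _
  rw [if_neg]
  rintro ⟨rfl, H⟩
  exact hP (H n le_rfl)

theorem auxF_big (P : ℤ → Prop) (a : ℕ → ℤ → ℂ) (p : ℕ) (q : ℤ) (n : ℕ) :
    ∀ h : ℤ, q + n < h → auxF P a p q n h = 0 := by
  induction n with
  | zero =>
    intro h hh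
    rw [auxF_zero, if_neg]
    rintro ⟨rfl, _⟩
    simp at hh
  | succ n ih =>
    intro h hh
    by_cases hP : P h
    · rw [auxF_succ _ _ _ _ _ _ hP]
      apply Finset.sum_eq_zero
      intro v _
      rw [ih _ (by push_cast at hh; omega), mul_zero]
    · exact auxF_not _ _ _ _ _ _ hP

theorem aux_main (a : ℕ → ℤ → ℂ) (p : ℕ) (i : ℕ) (n : ℕ) :
    ∀ h : ℤ, (i : ℤ) + 1 ≤ h → auxF (fun _ => True) a p 0 n h =
      ∑ k ∈ Finset.range n, auxF (fun _ => True) a p 0 k i *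
        auxF (fun x => (i : ℤ) + 1 ≤ x) a p (i + 1) (n - 1 - k) h := by
  induction n with
  | zero =>
    intro h hh
    rw [auxF_zero, if_neg (by omega)]
    simp
  | succ n ih =>
    intro h hh
    rw [auxF_succ _ _ _ _ _ _ trivial, Finset.sum_range_succ]
    have e1 : ∀ k ∈ Finset.range n, auxF (fun _ => True) a p 0 k i *
        auxF (fun x => (i : ℤ) + 1 ≤ x) a p (i + 1) (n + 1 - 1 - k) h =
        ∑ v : Fin (p + 2), auxC a v h * (auxF (fun _ => True) a p 0 k i *
          auxF (fun x => (i : ℤ) + 1 ≤ x) a p (i + 1) (n - 1 - k) (h - 1 + ((v : ℕ) : ℤ))) := by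
      intro k hk
      have hk := Finset.mem_range.mp hk
      rw [show n + 1 - 1 - k = (n - 1 - k) + 1 by omega, auxF_succ _ _ _ _ _ _ hh, Finset.mul_sum]
      apply Finset.sum_congr rfl
      intro v _
      ring
    rw [Finset.sum_congr rfl e1, Finset.sum_comm]
    simp only [← Finset.mul_sum]
    rw [Fin.sum_univ_succ, Fin.sum_univ_succ (n := p + 1)]
    have e2 : ∀ v : Fin (p + 1), auxF (fun _ => True) a p 0 n (h - 1 + ((v.succ : ℕ) : ℤ)) =
      ∑ k ∈ Finset.range n, auxF (fun _ => True) a p 0 k i *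
        auxF (fun x => (i : ℤ) + 1 ≤ x) a p (i + 1) (n - 1 - k) (h - 1 + ((v.succ : ℕ) : ℤ)) := by
      intro v
      apply ih
      rw [Fin.val_succ]; push_cast; omega
    simp only [e2]
    rw [show n + 1 - 1 - n = 0 by omega, auxF_zero]
    by_cases hi : h = i + 1
    · subst hi
      have e3 : ∀ k, auxF (fun x => (i : ℤ) + 1 ≤ x) a p (i + 1) k
          ((i : ℤ) + 1 - 1 + (((0 : Fin (p + 2)) : ℕ) : ℤ)) = 0 := by
        intro k
        apply auxF_not
        simp
      simp only [e3]
      simp [auxC]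
      ring
    · rw [ih (h - 1 + (((0 : Fin (p + 2)) : ℕ) : ℤ)) (by simp; omega), if_neg (by omega)]
      ring

theorem aux_W (a : ℕ → ℤ → ℂ) (p n j : ℕ) :
    Wpoly a p n j = auxF (fun _ => True) a p 0 n j := by
  classical
  unfold Wpoly auxF Pset
  rw [Finset.sum_filter]
  simp

theorem aux_ht_shift {p n : ℕ} (q : ℤ) (γ : Fin n → Fin (p + 2)) (k : ℕ) :
    ht q γ k = q + ht 0 γ k := by
  unfold ht; ring

theorem aux_A (a : ℕ → ℤ → ℂ) (p : ℕ) (q : ℤ) (n j : ℕ) :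
    Apoly a p q n j = auxF (fun x => q ≤ x) a p q n (q + j) := by
  classical
  unfold Apoly auxF Dset
  rw [Finset.sum_filter]
  apply Finset.sum_congr rfl
  intro γ _
  simp only [aux_ht_shift q, add_right_inj, le_add_iff_nonneg_right]

/-- For every `0 ≤ i < j ≤ p` and `n ≥ j`,
`W_{[n,j]} = Σ_{k=i}^{n-j+i} W_{[k,i]} · A^{(i+1)}_{[n-k-1,j-i-1]}`. -/
theorem stmt4 (p : ℕ) (hp : 1 ≤ p) (a : ℕ → ℤ → ℂ) (i j n : ℕ)
    (hij : i < j) (hjp : j ≤ p) (hn : j ≤ n) :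
    Wpoly a p n j =
      ∑ k ∈ Finset.Icc i (n - j + i),
        Wpoly a p k i * Apoly a p ((i : ℤ) + 1) (n - k - 1) (j - i - 1) := by
  simp only [aux_W, aux_A]
  have hc : (i : ℤ) + 1 + ((j - i - 1 : ℕ) : ℤ) = j := by omega
  rw [hc, aux_main a p i n j (by omega)]
  symm
  have e : ∀ k, n - k - 1 = n - 1 - k := by intro k; omega
  simp only [e]
  apply Finset.sum_subset
  · intro k hk
    rw [Finset.mem_Icc] at hk
    rw [Finset.mem_range]; omega
  · intro k hk hk'
    rw [Finset.mem_range] at hk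
    rw [Finset.mem_Icc] at hk'
    by_cases hki : k < i
    · rw [auxF_big _ _ _ _ k _ (by omega), zero_mul]
    · rw [auxF_big _ _ _ _ (n - 1 - k) _ (by omega), mul_zero]
end

section
/- Adopt the convention A^{(1)}_{[t,−1]} = B^{(1)}_{[t,−1]} = δ_{t,−1} (equal to 1 if t = −1 and 0 otherwise, for t ∈ ℤ). Then for every n ≥ 1, W_{[n,0]} = a^{(0)}_0 W_{[n−1,0]} + Σ_{j=1}^{p} Σ_{s=0}^{j} Σ_{ℓ∈ℤ} Σ_{k∈ℤ} a^{(j)}_{−s} · A^{(1)}_{[ℓ−1, j−s−1]} · B^{(1)}_{[k−ℓ−1, s−1]} · W_{[n−k−1,0]}, where all but finitely many terms of the sums over ℓ and k vanish. (Equivalently, W_0(z) = 1/( z − a^{(0)}_0 − Σ_{j=1}^{p} Σ_{s=0}^{j} a^{(j)}_{−s} A^{(1)}_{j−s−1}(z) B^{(1)}_{s−1}(z) ) with A^{(1)}_{−1}(z) ≡ B^{(1)}_{−1}(z) ≡ 1.) -/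
open Finset

/-- `W_{[n,0]}` extended to `n ∈ ℤ` by the convention that it vanishes for `n < 0`. -/
noncomputable def WZ (a : ℕ → ℤ → ℂ) (p : ℕ) (n : ℤ) (j : ℕ) : ℂ :=
  if 0 ≤ n then Wpoly a p n.toNat j else 0

/-- `A^{(1)}_{[t,r]}` for `t r : ℤ`, with the conventions `A^{(1)}_{[t,-1]} = δ_{t,-1}`
and `A^{(1)}_{[t,r]} = 0` for `t < 0`. -/
noncomputable def A1Z (a : ℕ → ℤ → ℂ) (p : ℕ) (t r : ℤ) : ℂ :=
  if r = -1 then (if t = -1 then 1 else 0)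
  else if 0 ≤ t ∧ 0 ≤ r then Apoly a p 1 t.toNat r.toNat else 0

/-- `B^{(1)}_{[t,r]}` for `t r : ℤ`, with the conventions `B^{(1)}_{[t,-1]} = δ_{t,-1}`
and `B^{(1)}_{[t,r]} = 0` for `t < 0`. -/
noncomputable def B1Z (a : ℕ → ℤ → ℂ) (p : ℕ) (t r : ℤ) : ℂ :=
  if r = -1 then (if t = -1 then 1 else 0)
  else if 0 ≤ t ∧ 0 ≤ r then Bpoly a p 1 t.toNat r.toNat else 0

noncomputable def stp (a : ℕ → ℤ → ℂ) (v : ℕ) (h : ℤ) : ℂ :=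
  if v = 0 then 1 else a (v - 1) (h + 1 - v)

open Classical in
noncomputable def GG (a : ℕ → ℤ → ℂ) (p : ℕ) (S : ℤ → Prop) (t : ℤ) : ℕ → ℤ → ℂ
  | 0, h => if S h ∧ h = t then 1 else 0
  | (n+1), h => if S h then ∑ v ∈ range (p + 2), stp a v h * GG a p S t n (h + 1 - v) else 0

lemma GG_not (a : ℕ → ℤ → ℂ) (p : ℕ) (S : ℤ → Prop) (t : ℤ) (n : ℕ) (h : ℤ) (hS : ¬ S h) :
    GG a p S t n h = 0 := by
  cases n <;> simp [GG, hS]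

lemma ht_cons_succ {p n : ℕ} (h0 : ℤ) (v : Fin (p+2)) (γ : Fin n → Fin (p+2)) (k : ℕ) :
    ht h0 (Fin.cons v γ : Fin (n+1) → Fin (p+2)) (k+1) = ht (h0 + 1 - ((v : ℕ) : ℤ)) γ k := by
  unfold ht
  rw [Finset.sum_range_succ']
  have : ∀ i : ℕ, (if h : i + 1 < n + 1 then
      1 - (((Fin.cons v γ : Fin (n+1) → Fin (p+2)) ⟨i+1, h⟩ : ℕ) : ℤ) else 0)
      = if h : i < n then 1 - ((γ ⟨i, h⟩ : ℕ) : ℤ) else 0 := by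
    intro i
    by_cases h : i < n
    · have h' : i + 1 < n + 1 := by omega
      rw [dif_pos h, dif_pos h']
      have : (⟨i+1, h'⟩ : Fin (n+1)) = Fin.succ ⟨i, h⟩ := rfl
      rw [this, Fin.cons_succ]
    · rw [dif_neg h, dif_neg (by omega)]
  simp only [this]
  have h0' : (⟨0, Nat.succ_pos n⟩ : Fin (n+1)) = 0 := rfl
  rw [dif_pos (Nat.succ_pos n), h0', Fin.cons_zero]
  ring

lemma ht_zero' {p n : ℕ} (h0 : ℤ) (γ : Fin n → Fin (p+2)) : ht h0 γ 0 = h0 := by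
  simp [ht]

lemma wt_cons (a : ℕ → ℤ → ℂ) {p n : ℕ} (h0 : ℤ) (v : Fin (p+2)) (γ : Fin n → Fin (p+2)) :
    wt a h0 (Fin.cons v γ : Fin (n+1) → Fin (p+2))
      = stp a v h0 * wt a (h0 + 1 - ((v : ℕ) : ℤ)) γ := by
  unfold wt
  rw [Fin.prod_univ_succ]
  congr 1
  · simp only [Fin.cons_zero, Fin.val_zero]
    rw [ht_cons_succ, ht_zero']
    rfl
  · apply Finset.prod_congr rfl
    intro i _
    simp only [Fin.cons_succ, Fin.val_succ]
    rw [ht_cons_succ]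

open Classical in
lemma GG_eq (a : ℕ → ℤ → ℂ) (p : ℕ) (S : ℤ → Prop) (t : ℤ) (n : ℕ) : ∀ h : ℤ,
    ∑ γ ∈ (Finset.univ : Finset (Fin n → Fin (p+2))).filter
      (fun γ => ht h γ n = t ∧ ∀ k ≤ n, S (ht h γ k)), wt a h γ = GG a p S t n h := by
  induction n with
  | zero =>
    intro h
    rw [Finset.sum_filter]
    simp [GG, ht_zero', wt, and_comm]
  | succ n ih =>
    intro h
    rw [Finset.sum_filter, ← (Fin.consEquiv (fun _ : Fin (n+1) => Fin (p+2))).sum_comp,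
      Fintype.sum_prod_type]
    change ∑ v : Fin (p+2), ∑ γ : Fin n → Fin (p+2), (if (ht h (Fin.cons v γ : Fin (n+1) → Fin (p+2)) (n+1) = t ∧
          ∀ k ≤ n+1, S (ht h (Fin.cons v γ : Fin (n+1) → Fin (p+2)) k)) then
          wt a h (Fin.cons v γ : Fin (n+1) → Fin (p+2)) else 0) = _
    have key : ∀ (v : Fin (p+2)) (γ : Fin n → Fin (p+2)),
        (ht h (Fin.cons v γ : Fin (n+1) → Fin (p+2)) (n+1) = t ∧
          ∀ k ≤ n+1, S (ht h (Fin.cons v γ : Fin (n+1) → Fin (p+2)) k)) ↔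
        (S h ∧ (ht (h + 1 - ((v : ℕ) : ℤ)) γ n = t ∧
          ∀ k ≤ n, S (ht (h + 1 - ((v : ℕ) : ℤ)) γ k))) := by
      intro v γ
      rw [ht_cons_succ]
      constructor
      · rintro ⟨h1, h2⟩
        refine ⟨?_, h1, fun k hk => ?_⟩
        · simpa [ht_zero'] using h2 0 (by omega)
        · simpa [ht_cons_succ] using h2 (k+1) (by omega)
      · rintro ⟨h0, h1, h2⟩
        refine ⟨h1, fun k hk => ?_⟩
        cases k with
        | zero => simpa [ht_zero'] using h0
        | succ k => rw [ht_cons_succ]; exact h2 k (by omega)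
    simp only [key, wt_cons]
    by_cases hS : S h
    · simp only [hS, true_and, GG, if_true]
      rw [← Fin.sum_univ_eq_sum_range (fun v => stp a v h * GG a p S t n (h + 1 - v))]
      apply Finset.sum_congr rfl
      intro v _
      rw [← ih, Finset.mul_sum, Finset.sum_filter]
    · simp [hS, GG]

lemma ht_shift {p n : ℕ} (h0 : ℤ) (γ : Fin n → Fin (p+2)) (k : ℕ) :
    ht h0 γ k = h0 + ht 0 γ k := by
  simp [ht]

lemma W_eq (a : ℕ → ℤ → ℂ) (p n : ℕ) : Wpoly a p n 0 = GG a p (fun _ => True) 0 n 0 := by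
  classical
  rw [← GG_eq]
  unfold Wpoly Pset
  apply Finset.sum_congr _ (fun _ _ => rfl)
  ext γ
  simp

lemma A_eq (a : ℕ → ℤ → ℂ) (p n j : ℕ) :
    Apoly a p 1 n j = GG a p (fun x => 1 ≤ x) (j + 1) n 1 := by
  classical
  rw [← GG_eq]
  unfold Apoly Dset
  apply Finset.sum_congr _ (fun _ _ => rfl)
  ext γ
  simp only [Finset.mem_filter, Finset.mem_univ, true_and, ht_shift (1 : ℤ) γ]
  refine and_congr (by omega) (forall₂_congr fun k _ => by omega)

lemma B_eq (a : ℕ → ℤ → ℂ) (p n j : ℕ) :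
    Bpoly a p 1 n j = GG a p (fun x => x ≤ -1) (-1) n (-(j : ℤ) - 1) := by
  classical
  rw [← GG_eq]
  unfold Bpoly Bhset
  apply Finset.sum_congr _ (fun _ _ => rfl)
  ext γ
  simp only [Finset.mem_filter, Finset.mem_univ, true_and, ht_shift (-(j : ℤ) - 1) γ,
    ht_shift (-(j : ℤ)) γ]
  refine and_congr (by omega) (forall₂_congr fun k _ => by omega)

noncomputable def WW (a : ℕ → ℤ → ℂ) (p : ℕ) (n : ℕ) (h : ℤ) : ℂ := GG a p (fun _ => True) 0 n h

lemma WW_succ (a : ℕ → ℤ → ℂ) (p n : ℕ) (h : ℤ) :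
    WW a p (n+1) h = ∑ v ∈ range (p + 2), stp a v h * WW a p n (h + 1 - v) := by
  simp [WW, GG]

open Classical in
lemma first_exit (a : ℕ → ℤ → ℂ) (p : ℕ) (S : ℤ → Prop) (hS0 : ¬ S 0) (E : ℕ → ℤ → ℕ → ℂ)
    (hE0 : ∀ h N, S h → E 0 h N =
      ∑ v ∈ range (p + 2), if S (h + 1 - v) then 0 else stp a v h * WW a p N (h + 1 - v))
    (hEs : ∀ m h N, S h → E (m+1) h N = ∑ v ∈ range (p + 2), stp a v h * E m (h + 1 - v) N)
    (hEn : ∀ m h N, ¬ S h → E m h N = 0) (n : ℕ) :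
    ∀ h, S h → WW a p n h = ∑ m ∈ range n, E m h (n - 1 - m) := by
  induction n with
  | zero =>
    intro h hS
    have : h ≠ 0 := by rintro rfl; exact hS0 hS
    simp [WW, GG, this]
  | succ n ih =>
    intro h hS
    rw [WW_succ, Finset.sum_range_succ' (fun m => E m h (n + 1 - 1 - m)), hE0 _ _ hS]
    simp only [hEs _ _ _ hS]
    rw [Finset.sum_comm, ← Finset.sum_add_distrib]
    apply Finset.sum_congr rfl
    intro v _
    rw [← Finset.mul_sum]
    by_cases hv : S (h + 1 - v)
    · rw [if_pos hv, ih _ hv, add_zero]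
      congr 1
      apply Finset.sum_congr rfl
      intro m _
      congr 1
      omega
    · rw [if_neg hv]
      simp [hEn _ _ _ hv]

lemma neg_exit (a : ℕ → ℤ → ℂ) (p n : ℕ) (h : ℤ) (hh : h ≤ -1) :
    WW a p n h = ∑ m ∈ range n, GG a p (fun x => x ≤ -1) (-1) m h * WW a p (n - 1 - m) 0 := by
  refine first_exit a p (fun x => x ≤ -1) (by simp)
    (fun m h N => GG a p (fun x => x ≤ -1) (-1) m h * WW a p N 0) ?_ ?_ ?_ n h hh
  · intro h N hS
    rw [Finset.sum_range_succ', Finset.sum_eq_zero]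
    · rcases eq_or_ne h (-1) with rfl | hne
      · simp [GG, stp]
      · have : h + 1 ≤ -1 := by omega
        simp [GG, hne, this]
    · intro v _
      rw [if_pos]
      push_cast; omega
  · intro m h N hS
    simp only [GG, hS, if_true, Finset.sum_mul, mul_assoc]
  · intro m h N hS
    simp [GG_not a p (fun x => x ≤ -1) (-1) m h hS]

lemma sum_Icc_range (f : ℕ → ℂ) (p : ℕ) : ∑ j ∈ Icc 1 p, f j = ∑ j ∈ range p, f (j+1) := by
  induction p with
  | zero => simp
  | succ p ih => rw [Finset.sum_Icc_succ_top (by omega), ih, Finset.sum_range_succ]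

lemma pos_exit (a : ℕ → ℤ → ℂ) (p n : ℕ) (h : ℤ) (hh : 1 ≤ h) :
    WW a p n h = ∑ m ∈ range n, ∑ j ∈ Icc 1 p, ∑ s ∈ range j,
      GG a p (fun x => 1 ≤ x) ((j : ℤ) - s) m h * (a j (-(s : ℤ)) * WW a p (n - 1 - m) (-(s : ℤ))) := by
  refine first_exit a p (fun x => 1 ≤ x) (by simp)
    (fun m h N => ∑ j ∈ Icc 1 p, ∑ s ∈ range j,
      GG a p (fun x => 1 ≤ x) ((j : ℤ) - s) m h * (a j (-(s : ℤ)) * WW a p N (-(s : ℤ)))) ?_ ?_ ?_ n h hh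
  · intro h N hS
    rw [Finset.sum_range_succ', Finset.sum_range_succ', sum_Icc_range]
    have h1 : (1 : ℤ) ≤ h + 1 - ((0 + 1 : ℕ) : ℤ) := by push_cast; omega
    have h2 : (1 : ℤ) ≤ h + 1 - ((0 : ℕ) : ℤ) := by push_cast; omega
    rw [if_pos h1, if_pos h2, add_zero, add_zero]
    apply Finset.sum_congr rfl
    intro j _
    by_cases hj : (1 : ℤ) ≤ h + 1 - ((j + 1 + 1 : ℕ) : ℤ)
    · rw [if_pos hj]
      apply Finset.sum_eq_zero
      intro s hs
      have : ¬ (1 ≤ h ∧ h = ((j + 1 : ℕ) : ℤ) - s) := by push_cast at *; omega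
      simp only [GG, this, if_false, zero_mul]
    · rw [if_neg hj]
      obtain ⟨d, hd⟩ : ∃ d : ℕ, (d : ℤ) = (j : ℤ) + 1 - h := 
        ⟨((j : ℤ) + 1 - h).toNat, by push_cast at *; omega⟩
      rw [Finset.sum_eq_single d]
      · have : (1 ≤ h ∧ h = ((j + 1 : ℕ) : ℤ) - d) := by push_cast at *; omega
        have e : h + 1 - ((j + 1 + 1 : ℕ) : ℤ) = -(d : ℤ) := by push_cast at *; omega
        rw [e]
        simp only [GG, stp, e]
        rw [if_pos this]
        simp
      · intro s _ hs
        have : ¬ (1 ≤ h ∧ h = ((j + 1 : ℕ) : ℤ) - s) := by push_cast at *; omega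
        simp only [GG, this, if_false, zero_mul]
      · intro hd'
        exfalso
        apply hd'
        rw [Finset.mem_range]; omega
  · intro m h N hS
    simp only [GG, hS, if_true, Finset.sum_mul, Finset.mul_sum, mul_assoc]
    symm
    rw [Finset.sum_comm]
    apply Finset.sum_congr rfl
    intro j _
    rw [Finset.sum_comm]
  · intro m h N hS
    simp [fun t => GG_not a p (fun x => 1 ≤ x) t m h hS]

lemma finsum_int (f : ℤ → ℂ) (c : ℤ) (N : ℕ)
    (hf : ∀ k, f k ≠ 0 → c ≤ k ∧ k < c + N) : ∑ᶠ k, f k = ∑ m ∈ range N, f (c + m) := by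
  classical
  rw [finsum_eq_sum_of_support_subset (s := (range N).image (fun m : ℕ => c + (m : ℤ)))]
  · rw [Finset.sum_image]
    intro x _ y _ hxy
    simpa using hxy
  · intro k hk
    have := hf k hk
    simp only [Finset.coe_image, Set.mem_image, Finset.mem_coe, Finset.mem_range]
    exact ⟨(k - c).toNat, by omega, by omega⟩

noncomputable def WWZ (a : ℕ → ℤ → ℂ) (p : ℕ) (n : ℤ) (h : ℤ) : ℂ :=
  if 0 ≤ n then WW a p n.toNat h else 0

lemma WZ_eq (a : ℕ → ℤ → ℂ) (p : ℕ) (n : ℤ) : WZ a p n 0 = WWZ a p n 0 := by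
  simp only [WZ, WWZ, W_eq, WW]

lemma WWZ_ne {a : ℕ → ℤ → ℂ} {p : ℕ} {n h : ℤ} (H : WWZ a p n h ≠ 0) : 0 ≤ n := by
  by_contra h'
  simp [WWZ, h'] at H

lemma A1Z_ne {a : ℕ → ℤ → ℂ} {p : ℕ} {t r : ℤ} (H : A1Z a p t r ≠ 0) : -1 ≤ t := by
  by_contra h'
  apply H
  unfold A1Z
  rw [if_neg (by omega : ¬ t = -1), if_neg (by omega : ¬ (0 ≤ t ∧ 0 ≤ r)), ite_self]

lemma B1Z_ne {a : ℕ → ℤ → ℂ} {p : ℕ} {t r : ℤ} (H : B1Z a p t r ≠ 0) : -1 ≤ t := by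
  by_contra h'
  apply H
  unfold B1Z
  rw [if_neg (by omega : ¬ t = -1), if_neg (by omega : ¬ (0 ≤ t ∧ 0 ≤ r)), ite_self]

lemma B1Z_zero (a : ℕ → ℤ → ℂ) (p : ℕ) (t : ℤ) :
    B1Z a p t (((0 : ℕ) : ℤ) - 1) = if t = -1 then 1 else 0 := by
  simp [B1Z]

lemma B1Z_succ (a : ℕ → ℤ → ℂ) (p : ℕ) (t : ℤ) (s : ℕ) :
    B1Z a p t (((s + 1 : ℕ) : ℤ) - 1) =
      if 0 ≤ t then GG a p (fun x => x ≤ -1) (-1) t.toNat (-((s+1 : ℕ) : ℤ)) else 0 := by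
  have e : (((s + 1 : ℕ) : ℤ) - 1) = s := by push_cast; ring
  have e2 : (-((s+1 : ℕ) : ℤ)) = -(s : ℤ) - 1 := by push_cast; ring
  rw [e, e2, ← B_eq]
  unfold B1Z
  rw [if_neg (by omega)]
  simp

lemma A1Z_pos (a : ℕ → ℤ → ℂ) (p : ℕ) (t : ℤ) (j s : ℕ) (h : s < j) :
    A1Z a p t ((j : ℤ) - s - 1) =
      if 0 ≤ t then GG a p (fun x => 1 ≤ x) ((j : ℤ) - s) t.toNat 1 else 0 := by
  obtain ⟨d, rfl⟩ : ∃ d, j = s + d + 1 := ⟨j - s - 1, by omega⟩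
  have e : (((s + d + 1 : ℕ) : ℤ) - s - 1) = d := by push_cast; ring
  have e2 : (((s + d + 1 : ℕ) : ℤ) - s) = d + 1 := by push_cast; ring
  rw [e, e2, ← A_eq]
  unfold A1Z
  rw [if_neg (by omega)]
  simp

lemma B_conv (a : ℕ → ℤ → ℂ) (p : ℕ) (s : ℕ) (N l : ℤ) :
    ∑ᶠ k : ℤ, B1Z a p (k - l - 1) ((s : ℤ) - 1) * WWZ a p (N - k - 1) 0
      = WWZ a p (N - l - 1) (-(s : ℤ)) := by
  cases s with
  | zero =>
    rw [finsum_int _ l 1]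
    · simp [B1Z]
    · intro k hk
      have := left_ne_zero_of_mul hk
      rw [B1Z_zero] at this
      have : k - l - 1 = -1 := by by_contra h; simp [h] at this
      push_cast; omega
  | succ s =>
    by_cases hN : 0 ≤ N - l - 1
    · obtain ⟨M, hM⟩ : ∃ M : ℕ, N - l - 1 = M := ⟨(N - l - 1).toNat, by omega⟩
      rw [finsum_int _ (l+1) M]
      · rw [hM]
        have : WWZ a p M (-((s+1 : ℕ) : ℤ)) = WW a p M (-((s+1 : ℕ) : ℤ)) := by simp [WWZ]
        rw [this, neg_exit _ _ _ _ (by push_cast; omega)]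
        apply Finset.sum_congr rfl
        intro m hm
        rw [Finset.mem_range] at hm
        rw [B1Z_succ, if_pos (by omega), WWZ, if_pos (by omega)]
        congr 2 <;> omega
      · intro k hk
        have h1 := left_ne_zero_of_mul hk
        have h2 := WWZ_ne (right_ne_zero_of_mul hk)
        rw [B1Z_succ] at h1
        have : 0 ≤ k - l - 1 := by
          by_contra h
          rw [if_neg h] at h1
          exact h1 rfl
        omega
    · rw [WWZ, if_neg hN]
      refine (finsum_congr ?_).trans (finsum_zero (α := ℤ))
      intro k
      by_contra hk
      have h1 := left_ne_zero_of_mul hk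
      have h2 := WWZ_ne (right_ne_zero_of_mul hk)
      have h3 := B1Z_ne h1
      omega

lemma A_conv_diag (a : ℕ → ℤ → ℂ) (p : ℕ) (j : ℕ) (N : ℕ) :
    ∑ᶠ l : ℤ, A1Z a p (l - 1) ((j : ℤ) - j - 1) * WWZ a p (((N + 1 : ℕ) : ℤ) - l - 1) (-(j : ℤ))
      = WW a p N (-(j : ℤ)) := by
  rw [finsum_int _ 0 1]
  · simp [A1Z, WWZ]
  · intro k hk
    have := left_ne_zero_of_mul hk
    have : k - 1 = -1 := by by_contra h; simp [A1Z, h] at this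
    push_cast; omega

lemma A_conv (a : ℕ → ℤ → ℂ) (p : ℕ) (j s : ℕ) (hs : s < j) (N : ℕ) :
    ∑ᶠ l : ℤ, A1Z a p (l - 1) ((j : ℤ) - s - 1) * WWZ a p (((N + 1 : ℕ) : ℤ) - l - 1) (-(s : ℤ))
      = ∑ m ∈ range N, GG a p (fun x => 1 ≤ x) ((j : ℤ) - s) m 1 * WW a p (N - 1 - m) (-(s : ℤ)) := by
  rw [finsum_int _ 1 N]
  · apply Finset.sum_congr rfl
    intro m hm
    rw [Finset.mem_range] at hm
    rw [A1Z_pos _ _ _ _ _ hs, if_pos (by omega), WWZ, if_pos (by omega)]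
    congr 2 <;> omega
  · intro k hk
    have h1 := left_ne_zero_of_mul hk
    have h2 := WWZ_ne (right_ne_zero_of_mul hk)
    rw [A1Z_pos _ _ _ _ _ hs] at h1
    have : 0 ≤ k - 1 := by
      by_contra h
      rw [if_neg h] at h1
      exact h1 rfl
    omega

lemma term_eq (a : ℕ → ℤ → ℂ) (p : ℕ) (j s n : ℕ) :
    ∑ᶠ l : ℤ, ∑ᶠ k : ℤ,
            a j (-(s : ℤ)) * A1Z a p (l - 1) ((j : ℤ) - s - 1) *
              B1Z a p (k - l - 1) ((s : ℤ) - 1) * WZ a p ((n : ℤ) - k - 1) 0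
    = a j (-(s : ℤ)) * ∑ᶠ l : ℤ, A1Z a p (l - 1) ((j : ℤ) - s - 1) *
        WWZ a p ((n : ℤ) - l - 1) (-(s : ℤ)) := by
  simp only [WZ_eq, mul_assoc, ← mul_finsum, B_conv]

/-- For every `n ≥ 1`:
`W_{[n,0]} = a^{(0)}_0 W_{[n-1,0]} + Σ_{j=1}^{p} Σ_{s=0}^{j} Σ_{ℓ∈ℤ} Σ_{k∈ℤ}
a^{(j)}_{-s} A^{(1)}_{[ℓ-1,j-s-1]} B^{(1)}_{[k-ℓ-1,s-1]} W_{[n-k-1,0]}`,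
where for each `j, s` all but finitely many of the terms over `(ℓ,k) ∈ ℤ × ℤ` vanish. -/
theorem stmt5 (p : ℕ) (hp : 1 ≤ p) (a : ℕ → ℤ → ℂ) (n : ℕ) (hn : 1 ≤ n) :
    (∀ j s : ℕ,
      (Function.support fun lk : ℤ × ℤ =>
        a j (-(s : ℤ)) * A1Z a p (lk.1 - 1) ((j : ℤ) - s - 1) *
          B1Z a p (lk.2 - lk.1 - 1) ((s : ℤ) - 1) * WZ a p ((n : ℤ) - lk.2 - 1) 0).Finite) ∧
    Wpoly a p n 0 =
      a 0 0 * Wpoly a p (n - 1) 0 +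
        ∑ j ∈ Finset.Icc 1 p, ∑ s ∈ Finset.range (j + 1),
          ∑ᶠ l : ℤ, ∑ᶠ k : ℤ,
            a j (-(s : ℤ)) * A1Z a p (l - 1) ((j : ℤ) - s - 1) *
              B1Z a p (k - l - 1) ((s : ℤ) - 1) * WZ a p ((n : ℤ) - k - 1) 0 := by
  refine ⟨?_, ?_⟩
  · intro j s
    apply Set.Finite.subset ((Set.finite_Icc (0 : ℤ) n).prod (Set.finite_Icc (0 : ℤ) n))
    rintro ⟨l, k⟩ h
    have h0 := left_ne_zero_of_mul h
    have h1 := right_ne_zero_of_mul h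
    have h2 := right_ne_zero_of_mul h0
    have h3 := right_ne_zero_of_mul (left_ne_zero_of_mul h0)
    dsimp only at h1 h2 h3
    rw [WZ_eq] at h1
    have h1' := WWZ_ne h1
    have h2' := B1Z_ne h2
    have h3' := A1Z_ne h3
    simp only [Set.mem_prod, Set.mem_Icc]
    omega
  · obtain ⟨N, rfl⟩ : ∃ N, n = N + 1 := ⟨n - 1, by omega⟩
    simp only [term_eq, Finset.sum_range_succ, A_conv_diag]
    have key : ∀ j : ℕ, ∀ s ∈ range j, a j (-(s : ℤ)) * ∑ᶠ l : ℤ,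
        A1Z a p (l - 1) ((j : ℤ) - s - 1) * WWZ a p (((N + 1 : ℕ) : ℤ) - l - 1) (-(s : ℤ))
        = ∑ m ∈ range N, GG a p (fun x => 1 ≤ x) ((j : ℤ) - s) m 1 *
          (a j (-(s : ℤ)) * WW a p (N - 1 - m) (-(s : ℤ))) := by
      intro j s hs
      rw [A_conv _ _ _ _ (Finset.mem_range.mp hs), Finset.mul_sum]
      apply Finset.sum_congr rfl
      intro m _
      ring
    rw [Finset.sum_add_distrib,
      Finset.sum_congr rfl (fun j _ => Finset.sum_congr rfl (key j))]
    have hpos := pos_exit a p N 1 le_rfl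
    rw [Finset.sum_comm] at hpos
    rw [Finset.sum_congr rfl (fun j _ => Finset.sum_comm), ← hpos]
    rw [W_eq, W_eq]
    change WW a p (N+1) 0 = a 0 0 * WW a p N 0 + _
    rw [WW_succ, Finset.sum_range_succ', Finset.sum_range_succ', sum_Icc_range]
    have e : ∀ j : ℕ, stp a (j+1+1) 0 * WW a p N (0 + 1 - ((j+1+1 : ℕ) : ℤ))
        = a (j+1) (-((j+1 : ℕ) : ℤ)) * WW a p N (-((j+1 : ℕ) : ℤ)) := by
      intro j
      have : (0 : ℤ) + 1 - ((j+1+1 : ℕ) : ℤ) = -((j+1 : ℕ) : ℤ) := by push_cast; ring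
      simp only [stp, this]
      simp
    rw [Finset.sum_congr rfl (fun j _ => e j)]
    simp [stp]
    ring
end
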